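/- Let n ≥ 3 be an integer and y = 2cos β_n. Then for (x, z) = (-2, 1-y) and for (x, z) = (2, -(1-y)), one has S_{n-1}(y)²*(z⁴ - 4z² + 2) + S_{n-2}(y)²*((x² - 1)(z² - 2) - x*(y*z - x)) - 2*S_{n-1}(y)*S_{n-2}(y)*(x*(z³ - 3z) - (y*(z² - 2) - (x*z - y))) = 2. (This trace computation shows that the eigenvalue of the canonical longitude under the representation ρ_± equals 1 at θ = β_n.) -/

import Mathlib

open Real

/-- The left endpoint `α_n` of the interval considered for the `(-2,3,2n+1)`-pretzel knot. -/
noncomputable def alphaN (n : ℕ) : ℝ :=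
  if n % 3 = 0 then 2 * π / 3 - π / (6 * (n : ℝ) + 15)
  else if n % 3 = 1 then 2 * π / 3 + π / (6 * (n : ℝ) - 3)
  else 2 * π / 3 - π / (2 * (n : ℝ) + 5)

/-- The right endpoint `β_n` of the interval considered for the `(-2,3,2n+1)`-pretzel knot. -/
noncomputable def betaN (n : ℕ) : ℝ :=
  if n % 3 = 0 then 2 * π / 3 + π / (6 * (n : ℝ) + 3)
  else if n % 3 = 1 then 2 * π / 3 + π / (2 * (n : ℝ) + 1)
  else 2 * π / 3 - π / (6 * (n : ℝ) + 3)

/-- The interior point `γ_n ∈ (α_n, β_n)`. -/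
noncomputable def gammaN (n : ℕ) : ℝ :=
  if n % 3 = 0 then 2 * π / 3
  else if n % 3 = 1 then 2 * π / 3 + 4 * π / (12 * (n : ℝ) + 9)
  else 2 * π / 3 - 4 * π / (12 * (n : ℝ) + 9)

/-- `F θ = 2 cos ((n+1)θ) cos (3θ/2) - cos ((2n+1)θ/2)`. -/
noncomputable def FN (n : ℕ) (θ : ℝ) : ℝ :=
  2 * Real.cos (((n : ℝ) + 1) * θ) * Real.cos (3 * θ / 2)
    - Real.cos ((2 * (n : ℝ) + 1) * θ / 2)

/-- `(2 n + 1) β_n` is an odd multiple of `π`. -/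
theorem exists_mul_betaN_eq (n : ℕ) :
    ∃ m : ℕ, (2 * (n : ℝ) + 1) * betaN n = (m : ℝ) * (2 * π) + π := by
  have h1 : (2 * (n : ℝ) + 1) ≠ 0 := by positivity
  have h2 : (6 * (n : ℝ) + 3) ≠ 0 := by positivity
  have hdiv : (n : ℝ) = 3 * ((n / 3 : ℕ) : ℝ) + ((n % 3 : ℕ) : ℝ) := by
    exact_mod_cast (Nat.div_add_mod n 3).symm
  have hlt : n % 3 < 3 := Nat.mod_lt n (by norm_num)
  have key : (2 * (n : ℝ) + 1) * (π / (6 * (n : ℝ) + 3)) = π / 3 := by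
    field_simp
    ring
  have key' : (2 * (n : ℝ) + 1) * (π / (2 * (n : ℝ) + 1)) = π := by
    field_simp
  rcases (by omega : n % 3 = 0 ∨ n % 3 = 1 ∨ n % 3 = 2) with h | h | h
  · refine ⟨2 * (n / 3), ?_⟩
    simp only [betaN, h, if_true]
    rw [mul_add, key]
    rw [h] at hdiv
    push_cast at hdiv ⊢
    linear_combination (4 * π / 3) * hdiv
  · refine ⟨2 * (n / 3) + 1, ?_⟩
    simp only [betaN, h, if_true, one_ne_zero, if_false]
    rw [mul_add, key']
    rw [h] at hdiv
    push_cast at hdiv ⊢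
    linear_combination (4 * π / 3) * hdiv
  · refine ⟨2 * (n / 3) + 1, ?_⟩
    simp only [betaN, h, OfNat.ofNat_ne_zero, OfNat.ofNat_ne_one, if_false]
    rw [mul_sub, key]
    rw [h] at hdiv
    push_cast at hdiv ⊢
    linear_combination (4 * π / 3) * hdiv

theorem betaN_mem_Ioo {n : ℕ} (hn : 3 ≤ n) : betaN n ∈ Set.Ioo 0 π := by
  have hn' : (3 : ℝ) ≤ n := by exact_mod_cast hn
  have hpi := pi_pos
  have h1 : π / (6 * (n : ℝ) + 3) ≤ π / 7 := by gcongr; linarith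
  have h2 : π / (2 * (n : ℝ) + 1) ≤ π / 7 := by gcongr; linarith
  have h3 : 0 < π / (6 * (n : ℝ) + 3) := by positivity
  have h4 : 0 < π / (2 * (n : ℝ) + 1) := by positivity
  unfold betaN
  split_ifs <;> constructor <;> linarith

/-- A sequence satisfying the recurrence of the Chebyshev polynomials of the second kind at
`2 cos θ` is determined by `s k * sin θ = sin ((k + 1) θ)`. -/
theorem chebyshev_mul_sin (s : ℤ → ℝ) (θ : ℝ) (h0 : s 0 = 1) (h1 : s 1 = 2 * cos θ)
    (hrec : ∀ k, s k = 2 * cos θ * s (k - 1) - s (k - 2)) (k : ℕ) :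
    s k * sin θ = sin (((k : ℝ) + 1) * θ) := by
  induction k using Nat.twoStepInduction with
  | zero => simp [h0]
  | one =>
    norm_num [h1, sin_two_mul]
    ring
  | more k ih0 ih1 =>
    have e := hrec ((k : ℤ) + 2)
    rw [show (k : ℤ) + 2 - 1 = k + 1 by ring, show (k : ℤ) + 2 - 2 = k by ring] at e
    push_cast at ih1 ⊢
    rw [e, show ((k : ℝ) + 2 + 1) * θ = ((k : ℝ) + 1 + 1) * θ + θ by ring, sin_add]
    rw [show ((k : ℝ) + 1) * θ = ((k : ℝ) + 1 + 1) * θ - θ by ring, sin_sub] at ih0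
    linear_combination 2 * cos θ * ih1 - ih0

/-- The quadratic invariant of the Chebyshev recurrence. -/
theorem chebyshev_sq_add_sq (s : ℤ → ℝ) (y : ℝ) (h0 : s 0 = 1) (h1 : s 1 = y)
    (hrec : ∀ k, s k = y * s (k - 1) - s (k - 2)) (k : ℕ) :
    s (k + 1) ^ 2 + s k ^ 2 - y * s (k + 1) * s k = 1 := by
  induction k with
  | zero =>
    simp only [Nat.cast_zero, zero_add, h0, h1]
    ring
  | succ k ih =>
    have e := hrec ((k : ℤ) + 1 + 1)
    rw [show (k : ℤ) + 1 + 1 - 1 = k + 1 by ring, show (k : ℤ) + 1 + 1 - 2 = k by ring] at e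
    push_cast
    rw [e]
    linear_combination ih

/-- trace computation for Proposition `L`. Let `S k` be the Chebyshev
polynomials of the second kind (`S 0 y = 1`, `S 1 y = y`,
`S k y = y * S (k-1) y - S (k-2) y` for all integers `k`). Let `n ≥ 3` and
`y = 2 cos β_n`. Then for `(x, z) = (-2, 1-y)` and for `(x, z) = (2, -(1-y))`,
`S (n-1) y ^ 2 * (z⁴ - 4z² + 2) + S (n-2) y ^ 2 * ((x² - 1)(z² - 2) - x (y z - x))
  - 2 S (n-1) y * S (n-2) y * (x (z³ - 3z) - (y (z² - 2) - (x z - y))) = 2`. -/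
theorem trace_longitude_at_beta
    (S : ℤ → ℝ → ℝ)
    (hS0 : ∀ y : ℝ, S 0 y = 1)
    (hS1 : ∀ y : ℝ, S 1 y = y)
    (hSrec : ∀ (k : ℤ) (y : ℝ), S k y = y * S (k - 1) y - S (k - 2) y)
    (n : ℕ) (hn : 3 ≤ n)
    (y : ℝ) (hy : y = 2 * Real.cos (betaN n)) :
    ∀ x z : ℝ, ((x = -2 ∧ z = 1 - y) ∨ (x = 2 ∧ z = -(1 - y))) →
      S ((n : ℤ) - 1) y ^ 2 * (z ^ 4 - 4 * z ^ 2 + 2)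
        + S ((n : ℤ) - 2) y ^ 2 * ((x ^ 2 - 1) * (z ^ 2 - 2) - x * (y * z - x))
        - 2 * S ((n : ℤ) - 1) y * S ((n : ℤ) - 2) y *
            (x * (z ^ 3 - 3 * z) - (y * (z ^ 2 - 2) - (x * z - y))) = 2 := by
  have hsin : sin (betaN n) ≠ 0 :=
    (sin_pos_of_pos_of_lt_pi (betaN_mem_Ioo hn).1 (betaN_mem_Ioo hn).2).ne'
  obtain ⟨k, rfl⟩ : ∃ k, n = k + 2 := ⟨n - 2, by omega⟩
  have hcheb := chebyshev_mul_sin (fun j => S j y) (betaN (k + 2)) (hS0 y) (by rw [hS1, hy])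
    (fun j => by rw [← hy]; exact hSrec j y)
  have hinv := chebyshev_sq_add_sq (fun j => S j y) y (hS0 y) (hS1 y) (fun j => hSrec j y) k
  have hsymm : S ((k : ℤ) + 2) y = S ((k : ℤ) + 1) y := by
    obtain ⟨m, hm⟩ := exists_mul_betaN_eq (k + 2)
    have e1 := hcheb (k + 1)
    have e2 := hcheb (k + 2)
    apply mul_right_cancel₀ hsin
    push_cast at e1 e2 hm
    rw [e1, e2, show ((k : ℝ) + 2 + 1) * betaN (k + 2)
      = π - ((k : ℝ) + 1 + 1) * betaN (k + 2) + m * (2 * π) by linear_combination hm,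
      sin_add_nat_mul_two_pi, sin_pi_sub]
  have e := hSrec ((k : ℤ) + 2) y
  rw [show (k : ℤ) + 2 - 1 = k + 1 by ring, show (k : ℤ) + 2 - 2 = k by ring, hsymm] at e
  have hk : S (k : ℤ) y = (y - 1) * S ((k : ℤ) + 1) y := by linear_combination e
  rw [show ((k + 2 : ℕ) : ℤ) - 1 = k + 1 by push_cast; ring,
    show ((k + 2 : ℕ) : ℤ) - 2 = k by push_cast; ring]
  simp only [hk] at hinv ⊢
  rintro x z (⟨rfl, rfl⟩ | ⟨rfl, rfl⟩) <;> linear_combination 2 * hinv
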